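/- For every natural number n ≥ 2, the word problem in the braid group B_n is decidable: there exists a computable function from words in the Artin generators (lists of pairs (i, ε) with i : Fin (n-1) and ε : Bool, ε recording whether the generator or its inverse is taken) to Bool which returns true exactly when the word evaluates to the identity element of B_n. -/

import Mathlib

/-- The Artin relators for the braid group `B n`: commutation relations
`σ i σ j = σ j σ i` for `|i - j| ≥ 2`, and braid relations
`σ i σ j σ i = σ j σ i σ j` for `|i - j| = 1`, written as relators in the
free group on `Fin (n - 1)`. -/
def artinRels (n : ℕ) : Set (FreeGroup (Fin (n - 1))) :=
  {r | ∃ i j : Fin (n - 1), ((i : ℕ) + 2 ≤ (j : ℕ) ∨ (j : ℕ) + 2 ≤ (i : ℕ)) ∧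
      r = FreeGroup.of i * FreeGroup.of j * (FreeGroup.of i)⁻¹ * (FreeGroup.of j)⁻¹} ∪
  {r | ∃ i j : Fin (n - 1), ((i : ℕ) + 1 = (j : ℕ) ∨ (j : ℕ) + 1 = (i : ℕ)) ∧
      r = FreeGroup.of i * FreeGroup.of j * FreeGroup.of i *
        (FreeGroup.of j * FreeGroup.of i * FreeGroup.of j)⁻¹}

/-- The braid group `B n` on `n` strands, presented with the `n - 1` Artin
generators `σ_1, …, σ_{n-1}` (indexed by `Fin (n - 1)`) and the Artin relations. -/
def BraidGroup (n : ℕ) : Type := PresentedGroup (artinRels n)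

instance (n : ℕ) : Group (BraidGroup n) := by unfold BraidGroup; infer_instance

/-- The Artin generator `σ_{i+1}` of `B n`, for `i : Fin (n - 1)`. -/
def braidGen (n : ℕ) (i : Fin (n - 1)) : BraidGroup n := PresentedGroup.of i

/-- Evaluation of a word in the Artin generators in the braid group `B n`:
a pair `(i, ε)` is read as `σ i` if `ε = true` and as `(σ i)⁻¹` if `ε = false`. -/
def evalWord (n : ℕ) (w : List (Fin (n - 1) × Bool)) : BraidGroup n :=
  (w.map fun p => if p.2 then braidGen n p.1 else (braidGen n p.1)⁻¹).prod

/-- Evaluation of a word with `ℕ`-indexed letters in the braid group `B n`: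
a pair `(i, ε)` with `i < n - 1` is read as `σ_{i+1}^{±1}` (sign according to `ε`);
out-of-range letters (which do not occur under our hypotheses) are read as `1`. -/
def evalWordNat (n : ℕ) (w : List (ℕ × Bool)) : BraidGroup n :=
  (w.map fun p =>
    if h : p.1 < n - 1 then
      (if p.2 then braidGen n ⟨p.1, h⟩ else (braidGen n ⟨p.1, h⟩)⁻¹)
    else 1).prod

/-- The word problem for the family `f` of elements of `G` is solved by a primitive recursive
function. -/
def HasPrimrecWordProblem {α G : Type} [Primcodable α] [Group G] (f : α → G) : Prop :=
  ∃ d : List (α × Bool) → Bool, Primrec d ∧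
    ∀ w, d w = true ↔ FreeGroup.lift f (FreeGroup.mk w) = 1

/-- Over a finite alphabet, free reduction of words is primitive recursive. -/
theorem primrec_freeGroup_reduce {α : Type} [Primcodable α] [DecidableEq α] [Finite α] :
    Primrec (FreeGroup.reduce : List (α × Bool) → List (α × Bool)) := by
  have hc : Primrec₂ fun (x y : α × Bool) => decide (x.1 = y.1 ∧ x.2 = !y.2) :=
    Primrec.dom_finite _
  have h : Primrec fun L : List (α × Bool) =>
      L.foldr (fun x ih => (List.casesOn ih [x] fun y tl =>
        bif decide (x.1 = y.1 ∧ x.2 = !y.2) then tl else x :: y :: tl : List (α × Bool))) [] := by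
    refine Primrec.list_foldr (h := fun _ p => (List.casesOn p.2 [p.1] fun y tl =>
        bif decide (p.1.1 = y.1 ∧ p.1.2 = !y.2) then tl else p.1 :: y :: tl : List (α × Bool)))
      Primrec.id (Primrec.const []) ?_
    have hx : Primrec fun q : List (α × Bool) × (α × Bool) × List (α × Bool) => q.2.1 :=
      Primrec.fst.comp Primrec.snd
    refine Primrec₂.mk <| Primrec.list_casesOn (h := fun q z =>
        bif decide (q.2.1.1 = z.1.1 ∧ q.2.1.2 = !z.1.2) then z.2 else q.2.1 :: z.1 :: z.2)
      (Primrec.snd.comp Primrec.snd)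
      (Primrec.list_cons.comp hx (Primrec.const [])) ?_
    have hx' := hx.comp (Primrec.fst (β := (α × Bool) × List (α × Bool)))
    have hy := (Primrec.fst (α := α × Bool) (β := List (α × Bool))).comp
      (Primrec.snd (α := List (α × Bool) × (α × Bool) × List (α × Bool)))
    have ht := (Primrec.snd (α := α × Bool) (β := List (α × Bool))).comp
      (Primrec.snd (α := List (α × Bool) × (α × Bool) × List (α × Bool)))
    exact Primrec₂.mk <| Primrec.cond (hc.comp hx' hy) ht
      (Primrec.list_cons.comp hx' (Primrec.list_cons.comp hy ht))
  refine h.of_eq fun L => ?_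
  induction L with
  | nil => rfl
  | cons x L ih =>
    rw [List.foldr_cons, ih, FreeGroup.reduce.cons]
    cases FreeGroup.reduce L with
    | nil => rfl
    | cons y tl => simp

theorem hasPrimrecWordProblem_freeGroup {α : Type} [Primcodable α] [Finite α] :
    HasPrimrecWordProblem (FreeGroup.of : α → FreeGroup α) := by
  classical
  refine ⟨fun w => decide (FreeGroup.reduce w = []),
    (Primrec.eq.decide.comp primrec_freeGroup_reduce (Primrec.const [])), fun w => ?_⟩
  rw [decide_eq_true_iff, FreeGroup.lift_of_eq_id, MonoidHom.id_apply, ← FreeGroup.toWord_mk,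
    FreeGroup.toWord_eq_nil_iff]

theorem lift_mk_cons {α G : Type} [Group G] (f : α → G) (a : α × Bool)
    (w : List (α × Bool)) :
    FreeGroup.lift f (FreeGroup.mk (a :: w)) =
      FreeGroup.lift f (FreeGroup.mk [a]) * FreeGroup.lift f (FreeGroup.mk w) := by
  rw [← map_mul, FreeGroup.mul_mk, List.singleton_append]

theorem exists_word_lift_eq {α G : Type} [Group G] {f : α → G}
    (hf : Function.Surjective (FreeGroup.lift f)) (g : G) :
    ∃ w : List (α × Bool), FreeGroup.lift f (FreeGroup.mk w) = g := by
  obtain ⟨u, rfl⟩ := hf g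
  obtain ⟨w, rfl⟩ := Quot.exists_rep u
  exact ⟨w, rfl⟩

/-- Substituting words for letters computes an endomorphism. -/
theorem lift_mk_flatMap {α G : Type} [Group G] {f : α → G} {e : G →* G}
    {s : α × Bool → List (α × Bool)}
    (hs : ∀ a, FreeGroup.lift f (FreeGroup.mk (s a)) = e (FreeGroup.lift f (FreeGroup.mk [a])))
    (w : List (α × Bool)) :
    FreeGroup.lift f (FreeGroup.mk (w.flatMap s)) = e (FreeGroup.lift f (FreeGroup.mk w)) := by
  induction w with
  | nil => simp [← FreeGroup.one_eq_mk]
  | cons a w ih =>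
    rw [List.flatMap_cons, ← FreeGroup.mul_mk, map_mul, ih, hs, ← map_mul, ← lift_mk_cons]

/-- The word problem for a semidirect product reduces to that of its two factors. -/
theorem HasPrimrecWordProblem.semidirectProduct {α β γ N Q : Type} [Primcodable α]
    [Primcodable β] [Primcodable γ] [Finite α] [Finite γ] [Group N] [Group Q]
    {φ : Q →* MulAut N} {f : α → N} {g : β → Q} (hf : HasPrimrecWordProblem f)
    (hg : HasPrimrecWordProblem g) (sf : Function.Surjective (FreeGroup.lift f))
    (sg : Function.Surjective (FreeGroup.lift g)) (r : γ → N ⋊[φ] Q) :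
    HasPrimrecWordProblem r := by
  obtain ⟨df, pf, hf⟩ := hf
  obtain ⟨dg, pg, hg⟩ := hg
  let r' : γ × Bool → N ⋊[φ] Q := fun a => FreeGroup.lift r (FreeGroup.mk [a])
  choose p hp using fun a => exists_word_lift_eq sf (r' a).left
  choose q hq using fun a => exists_word_lift_eq sg (r' a).right
  choose s hs using fun (x : (γ × Bool) × (α × Bool)) =>
    exists_word_lift_eq sf (φ (r' x.1).right (FreeGroup.lift f (FreeGroup.mk [x.2])))
  let step : (γ × Bool) × (List (α × Bool) × List (β × Bool)) →
      List (α × Bool) × List (β × Bool) :=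
    fun x => (p x.1 ++ x.2.1.flatMap fun y => s (x.1, y), q x.1 ++ x.2.2)
  have pstep : Primrec step := by
    refine Primrec.pair (Primrec.list_append.comp ((Primrec.dom_finite p).comp Primrec.fst) ?_)
      (Primrec.list_append.comp ((Primrec.dom_finite q).comp Primrec.fst)
        (Primrec.snd.comp Primrec.snd))
    exact Primrec.list_flatMap (Primrec.fst.comp Primrec.snd)
      ((Primrec.dom_finite s).comp ((Primrec.fst.comp Primrec.fst).pair Primrec.snd))
  let run : List (γ × Bool) → List (α × Bool) × List (β × Bool) :=
    fun w => w.foldr (fun a x => step (a, x)) ([], [])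
  have prun : Primrec run :=
    Primrec.list_foldr Primrec.id (Primrec.const ([], [])) (pstep.comp Primrec.snd)
  have hrun : ∀ w, FreeGroup.lift r (FreeGroup.mk w) =
      ⟨FreeGroup.lift f (FreeGroup.mk (run w).1), FreeGroup.lift g (FreeGroup.mk (run w).2)⟩ := by
    intro w
    induction w with
    | nil => simp [run, ← FreeGroup.one_eq_mk]
    | cons a w ih =>
      rw [lift_mk_cons, ih]
      change r' a * _ = SemidirectProduct.mk
        (FreeGroup.lift f (FreeGroup.mk (p a ++ (run w).1.flatMap fun y => s (a, y))))
        (FreeGroup.lift g (FreeGroup.mk (q a ++ (run w).2)))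
      rw [← FreeGroup.mul_mk, ← FreeGroup.mul_mk, map_mul, map_mul, hp, hq,
        lift_mk_flatMap (e := (φ (r' a).right).toMonoidHom) (fun y => hs (a, y))]
      rfl
  refine ⟨fun w => df (run w).1 && dg (run w).2,
    Primrec.and.comp (pf.comp (Primrec.fst.comp prun)) (pg.comp (Primrec.snd.comp prun)),
    fun w => ?_⟩
  rw [Bool.and_eq_true, hf, hg, hrun, SemidirectProduct.ext_iff]
  rfl

/-- A group acting on `ι × K` with `ι` finite, compatibly with right translations by `K`, and
such that only the identity fixes a base point, inherits a solution of the word problem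
from `K`. -/
theorem HasPrimrecWordProblem.of_action {α β ι K Γ : Type} [Primcodable α] [Primcodable β]
    [Primcodable ι] [Finite β] [Finite ι] [Group K] [Group Γ] {f : α → K}
    (hf : HasPrimrecWordProblem f) (sf : Function.Surjective (FreeGroup.lift f)) (r : β → Γ)
    (ρ : Γ →* Equiv.Perm (ι × K))
    (hρ : ∀ b k, Commute (ρ (r b)) ((Equiv.refl ι).prodCongr (Equiv.mulRight k)))
    (o : ι) (ho : ∀ g, ρ g (o, 1) = (o, 1) → g = 1) :
    HasPrimrecWordProblem r := by
  classical
  obtain ⟨d, pd, hd⟩ := hf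
  let r' : β × Bool → Γ := fun a => FreeGroup.lift r (FreeGroup.mk [a])
  have hr' : ∀ a j k, ρ (r' a) (j, k) = ((ρ (r' a) (j, 1)).1, (ρ (r' a) (j, 1)).2 * k) := by
    rintro ⟨b, ε⟩ j k
    have hc : Commute (ρ (r' (b, ε))) ((Equiv.refl ι).prodCongr (Equiv.mulRight k)) := by
      cases ε
      · simpa [r'] using (hρ b k).inv_left
      · simpa [r'] using hρ b k
    simpa [Prod.map] using congrArg (fun e : Equiv.Perm (ι × K) => e (j, 1)) hc.eq
  choose q hq using fun x : (β × Bool) × ι => exists_word_lift_eq sf (ρ (r' x.1) (x.2, 1)).2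
  let step : (β × Bool) × (ι × List (α × Bool)) → ι × List (α × Bool) :=
    fun x => ((ρ (r' x.1) (x.2.1, 1)).1, q (x.1, x.2.1) ++ x.2.2)
  have pkey : Primrec fun x : (β × Bool) × (ι × List (α × Bool)) => (x.1, x.2.1) :=
    Primrec.fst.pair (Primrec.fst.comp Primrec.snd)
  have pstep : Primrec step :=
    Primrec.pair ((Primrec.dom_finite fun x : (β × Bool) × ι => (ρ (r' x.1) (x.2, 1)).1).comp pkey)
      (Primrec.list_append.comp ((Primrec.dom_finite q).comp pkey)
        (Primrec.snd.comp Primrec.snd))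
  let run : List (β × Bool) → ι × List (α × Bool) :=
    fun w => w.foldr (fun a x => step (a, x)) (o, [])
  have prun : Primrec run :=
    Primrec.list_foldr Primrec.id (Primrec.const (o, [])) (pstep.comp Primrec.snd)
  have hrun : ∀ w, ρ (FreeGroup.lift r (FreeGroup.mk w)) (o, 1) =
      ((run w).1, FreeGroup.lift f (FreeGroup.mk (run w).2)) := by
    intro w
    induction w with
    | nil => simp [run, ← FreeGroup.one_eq_mk]
    | cons a w ih =>
      rw [lift_mk_cons, map_mul, Equiv.Perm.mul_apply, ih, hr']
      change _ = ((ρ (r' a) ((run w).1, 1)).1,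
        FreeGroup.lift f (FreeGroup.mk (q (a, (run w).1) ++ (run w).2)))
      rw [← FreeGroup.mul_mk, map_mul, hq]
  refine ⟨fun w => decide ((run w).1 = o) && d (run w).2,
    Primrec.and.comp (Primrec.eq.decide.comp (Primrec.fst.comp prun) (Primrec.const o))
      (pd.comp (Primrec.snd.comp prun)), fun w => ?_⟩
  rw [Bool.and_eq_true, hd, decide_eq_true_iff]
  constructor
  · rintro ⟨h₁, h₂⟩
    exact ho _ (by rw [hrun, h₁, h₂])
  · intro h
    have := hrun w
    rw [h, map_one, Equiv.Perm.one_apply, Prod.ext_iff] at this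
    exact ⟨this.1.symm, this.2.symm⟩

/-- The family `s` satisfies the Artin relations on its first `N` members. -/
structure ArtinRelations {G : Type} [Group G] (N : ℕ) (s : ℕ → G) : Prop where
  comm : ∀ i j, i + 2 ≤ j → j < N → s i * s j = s j * s i
  braid : ∀ i, i + 1 < N → s i * s (i + 1) * s i = s (i + 1) * s i * s (i + 1)

/-- The Artin generators of `B (m + 1)`, indexed by `ℕ` and trivial out of range. -/
def sigma (m i : ℕ) : BraidGroup (m + 1) := if h : i < m then braidGen (m + 1) ⟨i, h⟩ else 1

theorem sigma_val (m : ℕ) (i : Fin m) : sigma m i = braidGen (m + 1) i := dif_pos i.2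

theorem artinRelations_sigma (m : ℕ) : ArtinRelations m (sigma m) where
  comm i j h hj := by
    have hi : i < m := by omega
    have : (PresentedGroup.mk (artinRels (m + 1))) (FreeGroup.of ⟨i, hi⟩ * FreeGroup.of ⟨j, hj⟩ *
        (FreeGroup.of ⟨i, hi⟩)⁻¹ * (FreeGroup.of ⟨j, hj⟩)⁻¹) = 1 :=
      PresentedGroup.one_of_mem (Or.inl ⟨⟨i, hi⟩, ⟨j, hj⟩, Or.inl h, rfl⟩)
    rw [map_mul, map_mul, map_mul, map_inv, map_inv, mul_inv_eq_one, mul_inv_eq_iff_eq_mul] at this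
    rw [sigma, sigma, dif_pos hi, dif_pos hj]
    exact this
  braid i hj := by
    have hi : i < m := by omega
    have : (PresentedGroup.mk (artinRels (m + 1))) (FreeGroup.of ⟨i, hi⟩ *
        FreeGroup.of ⟨i + 1, hj⟩ * FreeGroup.of ⟨i, hi⟩ * (FreeGroup.of ⟨i + 1, hj⟩ *
        FreeGroup.of ⟨i, hi⟩ * FreeGroup.of ⟨i + 1, hj⟩)⁻¹) = 1 :=
      PresentedGroup.one_of_mem (Or.inr ⟨⟨i, hi⟩, ⟨i + 1, hj⟩, Or.inl rfl, rfl⟩)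
    rw [map_mul, map_inv, mul_inv_eq_one] at this
    rw [sigma, sigma, dif_pos hi, dif_pos hj]
    exact this

theorem ArtinRelations.exists_hom {G : Type} [Group G] {m : ℕ} {s : ℕ → G}
    (hs : ArtinRelations m s) :
    ∃ F : BraidGroup (m + 1) →* G, ∀ i < m, F (sigma m i) = s i := by
  have h : ∀ r ∈ artinRels (m + 1), FreeGroup.lift (fun i : Fin (m + 1 - 1) => s i) r = 1 := by
    rintro r (⟨i, j, hij, rfl⟩ | ⟨i, j, hij, rfl⟩)
    · simp only [map_mul, map_inv, FreeGroup.lift_apply_of]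
      rw [mul_inv_eq_one, mul_inv_eq_iff_eq_mul]
      rcases hij with hij | hij
      · exact hs.comm _ _ hij j.2
      · exact (hs.comm _ _ hij i.2).symm
    · simp only [map_mul, map_inv, FreeGroup.lift_apply_of]
      rw [mul_inv_eq_one]
      have hi : (i : ℕ) < m := i.2
      have hj : (j : ℕ) < m := j.2
      rcases hij with hij | hij
      · rw [← hij]
        exact hs.braid _ (by omega)
      · rw [← hij]
        exact (hs.braid _ (by omega)).symm
  refine ⟨PresentedGroup.toGroup h, fun i hi => ?_⟩
  rw [sigma, dif_pos hi]
  exact PresentedGroup.toGroup.of h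

theorem surjective_lift_sigma (m : ℕ) :
    Function.Surjective (FreeGroup.lift fun i : Fin m => sigma m i) := by
  intro g
  obtain ⟨u, hu⟩ := PresentedGroup.mk_surjective (artinRels (m + 1)) g
  refine ⟨u, ?_⟩
  rw [← hu]
  have : (FreeGroup.lift fun i : Fin m => sigma m i) = PresentedGroup.mk (artinRels (m + 1)) := by
    refine FreeGroup.ext_hom _ _ fun i => ?_
    rw [FreeGroup.lift_apply_of, sigma_val]
    rfl
  exact DFunLike.congr_fun this u

/-! ### The Artin action on the free group -/

/-- The generators of the free group of rank `m + 1`, indexed by `ℕ` and trivial out of range. -/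
def freeGen (m k : ℕ) : FreeGroup (Fin (m + 1)) :=
  if h : k < m + 1 then FreeGroup.of ⟨k, h⟩ else 1

theorem freeGen_val {m : ℕ} (k : Fin (m + 1)) : freeGen m k = FreeGroup.of k := dif_pos k.2

/-- The Artin endomorphism of the free group. -/
def artinHom (m i : ℕ) : FreeGroup (Fin (m + 1)) →* FreeGroup (Fin (m + 1)) :=
  FreeGroup.lift fun k => if (k : ℕ) = i then freeGen m (i + 1) else
    if (k : ℕ) = i + 1 then (freeGen m (i + 1))⁻¹ * freeGen m i * freeGen m (i + 1) else
      freeGen m k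

/-- The inverse of `artinHom m i`. -/
def artinInvHom (m i : ℕ) : FreeGroup (Fin (m + 1)) →* FreeGroup (Fin (m + 1)) :=
  FreeGroup.lift fun k => if (k : ℕ) = i + 1 then freeGen m i else
    if (k : ℕ) = i then freeGen m i * freeGen m (i + 1) * (freeGen m i)⁻¹ else freeGen m k

theorem artinHom_freeGen {m i k : ℕ} (hk : k < m + 1) : artinHom m i (freeGen m k) =
    if k = i then freeGen m (i + 1) else
    if k = i + 1 then (freeGen m (i + 1))⁻¹ * freeGen m i * freeGen m (i + 1) else
      freeGen m k := by
  conv_lhs => rw [freeGen, dif_pos hk, artinHom, FreeGroup.lift_apply_of]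

theorem artinInvHom_freeGen {m i k : ℕ} (hk : k < m + 1) : artinInvHom m i (freeGen m k) =
    if k = i + 1 then freeGen m i else
    if k = i then freeGen m i * freeGen m (i + 1) * (freeGen m i)⁻¹ else freeGen m k := by
  conv_lhs => rw [freeGen, dif_pos hk, artinInvHom, FreeGroup.lift_apply_of]

theorem freeGroup_hom_ext {G : Type} [Group G] {m : ℕ} {F F' : FreeGroup (Fin (m + 1)) →* G}
    (h : ∀ k < m + 1, F (freeGen m k) = F' (freeGen m k)) : F = F' :=
  FreeGroup.ext_hom _ _ fun k => by simpa only [freeGen_val] using h k k.2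

/-- The Artin automorphism of the free group. -/
def artinAut (m i : ℕ) : MulAut (FreeGroup (Fin (m + 1))) :=
  if hi : i < m then
    MonoidHom.toMulEquiv (artinHom m i) (artinInvHom m i)
      (freeGroup_hom_ext fun k hk => by
        have h₁ : i < m + 1 := by omega
        have h₂ : i + 1 < m + 1 := by omega
        simp only [MonoidHom.comp_apply, artinHom_freeGen hk, MonoidHom.id_apply]
        split_ifs with h h' <;>
          simp [artinInvHom_freeGen, *, mul_assoc])
      (freeGroup_hom_ext fun k hk => by
        have h₁ : i < m + 1 := by omega
        have h₂ : i + 1 < m + 1 := by omega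
        simp only [MonoidHom.comp_apply, artinInvHom_freeGen hk, MonoidHom.id_apply]
        split_ifs with h h' <;>
          simp [artinHom_freeGen, *, mul_assoc])
  else 1

theorem artinAut_freeGen {m i k : ℕ} (hi : i < m) (hk : k < m + 1) :
    artinAut m i (freeGen m k) =
    if k = i then freeGen m (i + 1) else
    if k = i + 1 then (freeGen m (i + 1))⁻¹ * freeGen m i * freeGen m (i + 1) else
      freeGen m k := by
  rw [artinAut, dif_pos hi]
  exact artinHom_freeGen hk

theorem mulAut_freeGroup_ext {m : ℕ} {e e' : MulAut (FreeGroup (Fin (m + 1)))}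
    (h : ∀ k < m + 1, e (freeGen m k) = e' (freeGen m k)) : e = e' :=
  MulEquiv.toMonoidHom_injective (freeGroup_hom_ext h)

theorem artinRelations_artinAut (m : ℕ) : ArtinRelations m (artinAut m) where
  comm i j h hj := by
    have hi : i < m := by omega
    have h₁ : i < m + 1 := by omega
    have h₂ : i + 1 < m + 1 := by omega
    have h₃ : j < m + 1 := by omega
    have h₄ : j + 1 < m + 1 := by omega
    have n₁ : i ≠ j := by omega
    have n₂ : i + 1 ≠ j := by omega
    have n₃ : i ≠ j + 1 := by omega
    refine mulAut_freeGroup_ext fun k hk => ?_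
    simp only [MulAut.mul_apply, artinAut_freeGen, hi, hj, hk]
    by_cases k₁ : k = i
    · simp [artinAut_freeGen, *]
    by_cases k₂ : k = i + 1
    · simp [artinAut_freeGen, *]
    by_cases k₃ : k = j
    · subst k₃
      simp [artinAut_freeGen, n₁.symm, n₂.symm, n₃.symm, *]
    by_cases k₄ : k = j + 1
    · simp [artinAut_freeGen, n₁.symm, n₂.symm, n₃.symm, *]
    simp [artinAut_freeGen, *]
  braid i hj := by
    have hi : i < m := by omega
    have h₁ : i < m + 1 := by omega
    have h₂ : i + 1 < m + 1 := by omega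
    have h₃ : i + 1 + 1 < m + 1 := by omega
    have n₁ : i ≠ i + 1 + 1 := by omega
    have n₂ : i + 1 + 1 ≠ i := by omega
    refine mulAut_freeGroup_ext fun k hk => ?_
    simp only [MulAut.mul_apply, artinAut_freeGen, hi, hj, hk]
    by_cases k₁ : k = i
    · simp [artinAut_freeGen, *]
    by_cases k₂ : k = i + 1
    · simp [artinAut_freeGen, *, mul_assoc]
    by_cases k₃ : k = i + 1 + 1
    · simp [artinAut_freeGen, *, mul_assoc]
    simp [artinAut_freeGen, *]

/-! ### The coset action -/

/-- Relations satisfied by the generators `x k` of the free group and `b i` of the braid group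
inside their semidirect product under the Artin action. -/
structure CombingRelations {G : Type} [Group G] (m : ℕ) (x b : ℕ → G) : Prop
    extends ArtinRelations m b where
  left : ∀ i < m, b i * x i = x (i + 1) * b i
  right : ∀ i < m, x (i + 1) * b i * x (i + 1) = x i * x (i + 1) * b i
  other : ∀ i k, i < m → k < m + 1 → k ≠ i → k ≠ i + 1 → b i * x k = x k * b i

/-- The transposition of `i` and `i + 1`. -/
def adjSwap (i j : ℕ) : ℕ := if j = i then i + 1 else if j = i + 1 then i else j

/-- The cocycle describing the action of the Artin generators on cosets of the
stabilizer of a strand. -/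
def combingCocycle {G : Type} [Group G] (x b : ℕ → G) (i j : ℕ) : G :=
  if j = i then 1 else if j = i + 1 then x i else if j < i then b (i - 1) else b i

theorem adjSwap_adjSwap (i j : ℕ) : adjSwap i (adjSwap i j) = j := by
  unfold adjSwap; split_ifs <;> omega

theorem adjSwap_lt {m i j : ℕ} (hi : i < m + 1) (hj : j < m + 2) : adjSwap i j < m + 2 := by
  unfold adjSwap; split_ifs <;> omega

theorem adjSwap_comm {i i' : ℕ} (h : i + 2 ≤ i') (j : ℕ) :
    adjSwap i (adjSwap i' j) = adjSwap i' (adjSwap i j) := by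
  unfold adjSwap; split_ifs <;> omega

theorem adjSwap_braid (i j : ℕ) :
    adjSwap i (adjSwap (i + 1) (adjSwap i j)) =
      adjSwap (i + 1) (adjSwap i (adjSwap (i + 1) j)) := by
  unfold adjSwap; split_ifs <;> omega

section Cocycle

variable {G : Type} [Group G] {m : ℕ} {x b : ℕ → G}

theorem CombingRelations.cocycle_comm (h : CombingRelations m x b) {i i' j : ℕ}
    (hi : i + 2 ≤ i') (hi' : i' < m + 1) (hj : j < m + 2) :
    combingCocycle x b i (adjSwap i' j) * combingCocycle x b i' j =
      combingCocycle x b i' (adjSwap i j) * combingCocycle x b i j := by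
  have hb := h.comm i (i' - 1)
  have hb' := h.comm (i - 1) (i' - 1)
  have hb'' := h.comm i i'
  have hx := h.other i i'
  have hx' := h.other (i' - 1) i
  unfold combingCocycle adjSwap
  split_ifs <;> first | omega | grind

theorem CombingRelations.cocycle_braid (h : CombingRelations m x b) {i j : ℕ}
    (hi : i + 1 < m + 1) (hj : j < m + 2) :
    combingCocycle x b i (adjSwap (i + 1) (adjSwap i j)) *
        (combingCocycle x b (i + 1) (adjSwap i j) * combingCocycle x b i j) =
      combingCocycle x b (i + 1) (adjSwap i (adjSwap (i + 1) j)) *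
        (combingCocycle x b i (adjSwap (i + 1) j) * combingCocycle x b (i + 1) j) := by
  rcases lt_or_ge j i with h₀ | h₀
  · have hb := h.braid (i - 1) (by omega)
    rw [show i - 1 + 1 = i by omega] at hb
    have e₁ : adjSwap i j = j := by grind [adjSwap]
    have e₂ : adjSwap (i + 1) j = j := by grind [adjSwap]
    have c₁ : combingCocycle x b i j = b (i - 1) := by grind [combingCocycle]
    have c₂ : combingCocycle x b (i + 1) j = b i := by grind [combingCocycle]
    simp only [e₁, e₂, c₁, c₂, ← mul_assoc, hb]
  have n₁ : i ≠ i + 1 + 1 := by omega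
  have n₂ : i + 1 + 1 ≠ i := by omega
  have n₃ : ¬i + 1 + 1 < i := by omega
  obtain rfl | rfl | rfl | h₁ : j = i ∨ j = i + 1 ∨ j = i + 1 + 1 ∨ i + 1 + 1 < j := by omega
  · simp [adjSwap, combingCocycle, n₁, n₂, n₃]
  · simp [adjSwap, combingCocycle, n₁, n₂, n₃, h.left i (by omega)]
  · have hr := h.right i (by omega)
    rw [← h.left i (by omega), mul_assoc] at hr
    simp [adjSwap, combingCocycle, n₁, n₂, n₃, hr, mul_assoc]
  · have hb := h.braid i (by omega)
    have e₁ : adjSwap i j = j := by grind [adjSwap]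
    have e₂ : adjSwap (i + 1) j = j := by grind [adjSwap]
    have c₁ : combingCocycle x b i j = b i := by grind [combingCocycle]
    have c₂ : combingCocycle x b (i + 1) j = b (i + 1) := by grind [combingCocycle]
    simp only [e₁, e₂, c₁, c₂, ← mul_assoc, hb]

/-- The permutation of `Fin (m + 2) × G` by which the `i`-th Artin generator acts. -/
def combingPerm (m : ℕ) (x b : ℕ → G) (i : ℕ) : Equiv.Perm (Fin (m + 2) × G) :=
  if hi : i < m + 1 then
    { toFun := fun p => (⟨adjSwap i p.1, adjSwap_lt hi p.1.2⟩, combingCocycle x b i p.1 * p.2)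
      invFun := fun p => (⟨adjSwap i p.1, adjSwap_lt hi p.1.2⟩,
        (combingCocycle x b i (adjSwap i p.1))⁻¹ * p.2)
      left_inv := fun p => by simp [adjSwap_adjSwap]
      right_inv := fun p => by simp [adjSwap_adjSwap] }
  else 1

theorem combingPerm_apply {i : ℕ} (hi : i < m + 1) (p : Fin (m + 2) × G) :
    combingPerm m x b i p =
      (⟨adjSwap i p.1, adjSwap_lt hi p.1.2⟩, combingCocycle x b i p.1 * p.2) := by
  rw [combingPerm, dif_pos hi]
  rfl

theorem CombingRelations.artinRelations_combingPerm (h : CombingRelations m x b) :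
    ArtinRelations (m + 1) (combingPerm m x b) where
  comm i j hij hj := by
    ext1 p
    have hi : i < m + 1 := by omega
    simp only [Equiv.Perm.mul_apply, combingPerm_apply hi, combingPerm_apply hj, ← mul_assoc,
      adjSwap_comm hij, h.cocycle_comm hij hj p.1.2]
  braid i hi' := by
    ext1 p
    have hi : i < m + 1 := by omega
    have := h.cocycle_braid hi' p.1.2
    simp only [← mul_assoc] at this
    simp only [Equiv.Perm.mul_apply, combingPerm_apply hi, combingPerm_apply hi', ← mul_assoc,
      adjSwap_braid, this]

end Cocycle

/-! ### Strand moves -/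

section StrandMove

variable {G : Type} [Group G] {m : ℕ} {s : ℕ → G}

/-- The product `s (k - 1) * ⋯ * s 0`, moving the first strand to position `k`. -/
def strandMove (s : ℕ → G) : ℕ → G
  | 0 => 1
  | k + 1 => s k * strandMove s k

/-- The pure braid in which the first strand runs once around the strand at position `k + 1`. -/
def strandLoop (s : ℕ → G) (k : ℕ) : G := (strandMove s k)⁻¹ * (s k * s k) * strandMove s k

theorem ArtinRelations.commute_strandMove (h : ArtinRelations m s) {k i : ℕ} (hk : k < i)
    (hi : i < m) : Commute (s i) (strandMove s k) := by
  induction k with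
  | zero => exact Commute.one_right _
  | succ k ih => exact Commute.mul_right (h.comm k i (by omega) hi).symm (ih (by omega))

theorem ArtinRelations.mul_strandMove (h : ArtinRelations m s) {i j : ℕ} (hij : i + 2 ≤ j)
    (hj : j ≤ m) : s i * strandMove s j = strandMove s j * s (i + 1) := by
  induction j, hij using Nat.le_induction with
  | base =>
    have := (h.commute_strandMove (k := i) (i := i + 1) (by omega) (by omega)).eq
    simp only [strandMove, mul_assoc, ← this]
    simp only [← mul_assoc, h.braid i (by omega)]
  | succ j hij ih =>
    simp only [strandMove]
    rw [← mul_assoc, h.comm i j hij (by omega), mul_assoc, ih (by omega), mul_assoc]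

theorem ArtinRelations.mul_strandLoop (h : ArtinRelations (m + 1) s) {i : ℕ} (hi : i < m) :
    s (i + 1) * strandLoop s i = strandLoop s (i + 1) * s (i + 1) := by
  have hc := h.commute_strandMove (k := i) (i := i + 1) (by omega) (by omega)
  have hb := h.braid i (by omega)
  have e : s (i + 1) * (s i * s i) = (s i)⁻¹ * (s (i + 1) * s (i + 1)) * s i * s (i + 1) := by
    rw [eq_comm, mul_assoc, mul_assoc, inv_mul_eq_iff_eq_mul]
    grind
  rw [strandLoop, strandLoop, strandMove, mul_inv_rev, ← mul_assoc, ← mul_assoc,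
    hc.inv_right.eq, mul_assoc _ (s (i + 1)), e]
  simp only [mul_assoc, hc.eq]

theorem ArtinRelations.strandLoop_mul (h : ArtinRelations (m + 1) s) {i : ℕ} (hi : i < m) :
    s (i + 1) * strandLoop s i * s (i + 1) * strandLoop s i =
      strandLoop s i * s (i + 1) * strandLoop s i * s (i + 1) := by
  have hc := h.commute_strandMove (k := i) (i := i + 1) (by omega) (by omega)
  have hb := h.braid i (by omega)
  have hq : Commute (s (i + 1) * (s i * s i) * s (i + 1)) (s i) := by
    calc _ = s (i + 1) * s i * (s i * s (i + 1) * s i) := by simp only [mul_assoc]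
      _ = s (i + 1) * s i * s (i + 1) * (s i * s (i + 1)) := by rw [hb]; simp only [mul_assoc]
      _ = _ := by rw [← hb]; simp only [mul_assoc]
  have hq' := (hq.mul_right hq).eq
  have hp : s (i + 1) = (strandMove s i)⁻¹ * s (i + 1) * strandMove s i := by
    rw [mul_assoc, hc.eq, inv_mul_cancel_left]
  rw [hp, strandLoop]
  simp only [mul_assoc, mul_inv_cancel_left] at hq' ⊢
  simp only [← mul_assoc, mul_left_inj] at hq' ⊢
  simp only [mul_assoc, mul_right_inj] at hq' ⊢
  exact hq'

theorem ArtinRelations.combingRelations_strandLoop (h : ArtinRelations (m + 1) s) :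
    CombingRelations m (strandLoop s) fun i => s (i + 1) where
  comm i j hij hj := h.comm _ _ (by omega) (by omega)
  braid i hi := h.braid _ (by omega)
  left i hi := h.mul_strandLoop hi
  right i hi := by
    have hl := eq_mul_inv_of_mul_eq (h.mul_strandLoop hi).symm
    have hc := h.strandLoop_mul hi
    rw [hl]
    calc _ = s (i + 1) * strandLoop s i * s (i + 1) * strandLoop s i * (s (i + 1))⁻¹ := by group
      _ = _ := by rw [hc]; group
  other i k hi hk hki hki' := by
    change Commute (s (i + 1)) (strandLoop s k)
    rcases Nat.lt_or_ge k i with hlt | hge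
    · have h₁ := h.commute_strandMove (k := k) (i := i + 1) (by omega) (by omega)
      have h₂ : Commute (s (i + 1)) (s k) := (h.comm k (i + 1) (by omega) (by omega)).symm
      exact (h₁.inv_right.mul_right (h₂.mul_right h₂)).mul_right h₁
    · have h₁ := h.mul_strandMove (i := i) (j := k) (by omega) (by omega)
      have h₂ : Commute (s i) (s k) := h.comm i k (by omega) (by omega)
      have h₃ : s (i + 1) = (strandMove s k)⁻¹ * s i * strandMove s k := by
        rw [mul_assoc, h₁, inv_mul_cancel_left]
      have h₄ := (h₂.mul_right h₂).eq
      rw [h₃, strandLoop, commute_iff_eq]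
      simp only [mul_assoc, mul_inv_cancel_left] at h₄ ⊢
      rw [← mul_assoc (s i), ← mul_assoc (s i * s k), mul_assoc (s i), h₄]
      simp only [mul_assoc]

theorem ArtinRelations.mul_strandMove_eq (h : ArtinRelations (m + 1) s) {i j : ℕ}
    (hi : i < m + 1) (hj : j < m + 2) :
    s i * strandMove s j = strandMove s (adjSwap i j) *
      combingCocycle (strandLoop s) (fun i => s (i + 1)) i j := by
  have n₁ : i ≠ i + 1 := by omega
  obtain rfl | rfl | hlt | hgt : j = i ∨ j = i + 1 ∨ j < i ∨ i + 1 < j := by omega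
  · simp [adjSwap, combingCocycle, strandMove]
  · simp [adjSwap, combingCocycle, strandMove, strandLoop, mul_assoc]
  · have e₁ : adjSwap i j = j := by grind [adjSwap]
    have c₁ : combingCocycle (strandLoop s) (fun i => s (i + 1)) i j = s i := by
      grind [combingCocycle]
    rw [e₁, c₁, (h.commute_strandMove hlt hi).eq]
  · have e₁ : adjSwap i j = j := by grind [adjSwap]
    have c₁ : combingCocycle (strandLoop s) (fun i => s (i + 1)) i j = s (i + 1) := by
      grind [combingCocycle]
    rw [e₁, c₁, h.mul_strandMove hgt (by omega)]

end StrandMove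

/-! ### Combing -/

section Combing

variable {m : ℕ} {φ : BraidGroup (m + 1) →* MulAut (FreeGroup (Fin (m + 1)))}

theorem combingRelations_semidirectProduct (hφ : ∀ i < m, φ (sigma m i) = artinAut m i) :
    CombingRelations m
      (fun k => (SemidirectProduct.inl (freeGen m k) : FreeGroup (Fin (m + 1)) ⋊[φ] _))
      fun i => SemidirectProduct.inr (sigma m i) := by
  have key : ∀ i < m, ∀ u : FreeGroup (Fin (m + 1)),
      (SemidirectProduct.inr (sigma m i) * SemidirectProduct.inl u :
        FreeGroup (Fin (m + 1)) ⋊[φ] _) =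
      SemidirectProduct.inl (artinAut m i u) * SemidirectProduct.inr (sigma m i) := by
    intro i hi u
    rw [← hφ i hi, SemidirectProduct.inl_aut]
    simp
  exact
  { comm := fun i j hij hj => by
      simp only [← map_mul, (artinRelations_sigma m).comm i j hij hj]
    braid := fun i hi => by
      simp only [← map_mul, (artinRelations_sigma m).braid i hi]
    left := fun i hi => by
      rw [key i hi, artinAut_freeGen hi (by omega), if_pos rfl]
    right := fun i hi => by
      rw [mul_assoc, key i hi, artinAut_freeGen hi (by omega), if_neg (by omega), if_pos rfl,
        ← mul_assoc, ← map_mul, ← map_mul]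
      simp only [mul_assoc, mul_inv_cancel_left]
    other := fun i k hi hk hki hki' => by
      rw [key i hi, artinAut_freeGen hi hk, if_neg hki, if_neg hki'] }

theorem CombingRelations.exists_hom {G : Type} [Group G] {x b : ℕ → G}
    (h : CombingRelations m x b) (hφ : ∀ i < m, φ (sigma m i) = artinAut m i) :
    ∃ F : FreeGroup (Fin (m + 1)) ⋊[φ] BraidGroup (m + 1) →* G,
      (∀ k < m + 1, F (SemidirectProduct.inl (freeGen m k)) = x k) ∧
      ∀ i < m, F (SemidirectProduct.inr (sigma m i)) = b i := by
  obtain ⟨B, hB⟩ := h.toArtinRelations.exists_hom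
  have hA : ∀ k < m + 1, FreeGroup.lift (fun k : Fin (m + 1) => x k) (freeGen m k) = x k := by
    intro k hk
    rw [freeGen, dif_pos hk, FreeGroup.lift_apply_of]
  have key : ∀ g, (FreeGroup.lift fun k : Fin (m + 1) => x k).comp (φ g).toMonoidHom =
      (MulAut.conj (B g)).toMonoidHom.comp (FreeGroup.lift fun k : Fin (m + 1) => x k) := by
    intro g
    obtain ⟨u, rfl⟩ := surjective_lift_sigma m g
    induction u using FreeGroup.induction_on with
    | C1 => ext; simp
    | of i =>
      refine freeGroup_hom_ext fun k hk => ?_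
      have hr := h.right i i.2
      have hl := h.left i i.2
      simp only [FreeGroup.lift_apply_of, MonoidHom.comp_apply, MulEquiv.coe_toMonoidHom,
        MulAut.conj_apply, hφ i i.2, hB i i.2, artinAut_freeGen i.2 hk, hA k hk]
      rw [eq_mul_inv_iff_mul_eq]
      split_ifs with h₁ h₂
      · rw [hA _ (by omega), h₁, hl]
      · rw [map_mul, map_mul, map_inv, hA _ (by omega), hA _ (by omega), h₂, mul_assoc, mul_assoc,
          inv_mul_eq_iff_eq_mul, ← mul_assoc, ← mul_assoc, hr]
      · rw [hA _ hk, h.other i k i.2 hk h₁ h₂]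
    | inv_of i hi =>
      ext k
      have := DFunLike.congr_fun hi ((φ (sigma m i))⁻¹ (FreeGroup.of k))
      simp only [FreeGroup.lift_apply_of, MonoidHom.comp_apply, MulEquiv.coe_toMonoidHom,
        map_inv, MulAut.apply_inv_self, MulAut.conj_apply] at this ⊢
      rw [this]
      simp [mul_assoc]
    | mul u v hu hv =>
      ext k
      have h₁ := DFunLike.congr_fun hu (φ (FreeGroup.lift (fun i : Fin m => sigma m i) v)
        (FreeGroup.of k))
      have h₂ := DFunLike.congr_fun hv (FreeGroup.of k)
      simp only [MonoidHom.comp_apply, MulEquiv.coe_toMonoidHom] at h₁ h₂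
      simp only [MonoidHom.comp_apply, MulEquiv.coe_toMonoidHom, map_mul, MulAut.mul_apply,
        h₁, h₂]
  refine ⟨SemidirectProduct.lift _ B key, fun k hk => ?_, fun i hi => ?_⟩
  · rw [SemidirectProduct.lift_inl, hA k hk]
  · rw [SemidirectProduct.lift_inr, hB i hi]

end Combing

/-- The word problem for the Artin generators of the braid group on `m + 1` strands is solved by
combing. -/
theorem hasPrimrecWordProblem_sigma (m : ℕ) :
    HasPrimrecWordProblem fun i : Fin m => sigma m i := by
  induction m with
  | zero =>
    refine ⟨fun _ => true, Primrec.const true, fun w => ?_⟩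
    obtain rfl : w = [] := List.eq_nil_iff_forall_not_mem.mpr fun a _ => a.1.elim0
    simp [← FreeGroup.one_eq_mk]
  | succ m ih =>
    obtain ⟨φ, hφ⟩ := (artinRelations_artinAut m).exists_hom
    have hK := combingRelations_semidirectProduct hφ
    obtain ⟨ρ, hρ⟩ := hK.artinRelations_combingPerm.exists_hom
    have hs := artinRelations_sigma (m + 1)
    obtain ⟨F, hFx, hFb⟩ := hs.combingRelations_strandLoop.exists_hom hφ
    have sx : Function.Surjective (FreeGroup.lift (FreeGroup.of : Fin (m + 1) → _)) := fun u =>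
      ⟨u, by rw [FreeGroup.lift_of_eq_id]; rfl⟩
    let k : Fin (m + 1) ⊕ Fin m → FreeGroup (Fin (m + 1)) ⋊[φ] BraidGroup (m + 1) :=
      Sum.elim (fun i => SemidirectProduct.inl (FreeGroup.of i))
        fun i => SemidirectProduct.inr (sigma m i)
    have hk : HasPrimrecWordProblem k := hasPrimrecWordProblem_freeGroup.semidirectProduct ih sx
      (surjective_lift_sigma m) k
    have sk : Function.Surjective (FreeGroup.lift k) := by
      have h₁ : (FreeGroup.lift k).comp (FreeGroup.map Sum.inl) = SemidirectProduct.inl :=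
        FreeGroup.ext_hom _ _ fun i => by simp [k]
      have h₂ : (FreeGroup.lift k).comp (FreeGroup.map Sum.inr) = SemidirectProduct.inr.comp
          (FreeGroup.lift fun i : Fin m => sigma m i) :=
        FreeGroup.ext_hom _ _ fun i => by simp [k]
      intro g
      obtain ⟨v, hv⟩ := surjective_lift_sigma m g.right
      refine ⟨FreeGroup.map Sum.inl g.left * FreeGroup.map Sum.inr v, ?_⟩
      rw [map_mul, ← MonoidHom.comp_apply, ← MonoidHom.comp_apply, h₁, h₂, MonoidHom.comp_apply,
        hv, SemidirectProduct.inl_left_mul_inr_right]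
    let ev : Fin (m + 2) × (FreeGroup (Fin (m + 1)) ⋊[φ] BraidGroup (m + 1)) →
        BraidGroup (m + 1 + 1) := fun p => strandMove (sigma (m + 1)) p.1 * F p.2
    have hev : ∀ g p, ev (ρ g p) = g * ev p := by
      intro g
      obtain ⟨u, rfl⟩ := surjective_lift_sigma (m + 1) g
      induction u using FreeGroup.induction_on with
      | C1 => simp
      | of i =>
        intro p
        have hc : F (combingCocycle (fun k => SemidirectProduct.inl (freeGen m k))
            (fun i => SemidirectProduct.inr (sigma m i)) i p.1) =
            combingCocycle (strandLoop (sigma (m + 1))) (fun i => sigma (m + 1) (i + 1)) i p.1 := by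
          have hp := p.1.2
          have hi := i.2
          unfold combingCocycle
          split_ifs
          · exact map_one F
          · exact hFx _ hi
          · exact hFb _ (by omega)
          · exact hFb _ (by omega)
        rw [FreeGroup.lift_apply_of, hρ i i.2, combingPerm_apply i.2]
        simp only [ev, map_mul, hc]
        rw [← mul_assoc, ← hs.mul_strandMove_eq i.2 p.1.2, mul_assoc]
      | inv_of i hi =>
        intro p
        rw [eq_comm, map_inv, inv_mul_eq_iff_eq_mul, ← hi, ← Equiv.Perm.mul_apply, ← map_mul,
          mul_inv_cancel, map_one, Equiv.Perm.one_apply]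
      | mul u v hu hv =>
        intro p
        rw [map_mul, map_mul, Equiv.Perm.mul_apply, hu, hv, mul_assoc]
    refine hk.of_action sk _ ρ (fun i g => ?_) 0 fun g hg => ?_
    · rw [hρ i i.2, commute_iff_eq]
      ext1 p
      simp [combingPerm_apply i.2, Prod.map, mul_assoc]
    · have := hev g (0, 1)
      rw [hg] at this
      exact (mul_eq_right.mp this.symm)

/-- For every `n ≥ 2`, the word problem in the braid group `B n` is decidable:
there is a computable function from words in the Artin generators to `Bool`
returning `true` exactly when the word evaluates to the identity of `B n`. -/
theorem braid_word_problem_decidable (n : ℕ) (hn : 2 ≤ n) :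
    ∃ f : List (Fin (n - 1) × Bool) → Bool,
      Computable f ∧
        ∀ w : List (Fin (n - 1) × Bool), f w = true ↔ evalWord n w = 1 := by
  obtain ⟨m, rfl⟩ : ∃ m, n = m + 1 := ⟨n - 1, by omega⟩
  obtain ⟨d, hd, h⟩ := hasPrimrecWordProblem_sigma m
  refine ⟨d, hd.to_comp, fun w => (h w).trans ?_⟩
  rw [FreeGroup.lift_mk, evalWord]
  simp only [sigma_val, Bool.cond_eq_ite]
  rfl
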